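/- (Multinomial likelihood lower bound) Let N be a nonnegative real, z ∈ ℝ^{D−1}, and ψ ∈ ℝ^{D−1}. Define z̃ = z − N(p_ψ − Aψ) and κ(ψ) = N(ψᵀ p_ψ − lse(ψ) − (1/2)ψᵀ A ψ). Then for every η ∈ ℝ^{D−1}: exp(ηᵀ z − N·lse(η)) ≥ exp(ηᵀ z̃ − (N/2)·ηᵀ A η + κ(ψ)). -/

import Mathlib

open scoped BigOperators
open Matrix

/-- The log-sum-exp function `lse(ψ) = log(1 + Σ_j exp(ψ_j))` on `ℝ^{D-1}`. -/
noncomputable def lse {n : ℕ} (ψ : Fin n → ℝ) : ℝ :=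
  Real.log (1 + ∑ j, Real.exp (ψ j))

/-- The induced probability vector `(p_ψ)_j = exp(ψ_j)/(1 + Σ_k exp(ψ_k))`. -/
noncomputable def probVec {n : ℕ} (ψ : Fin n → ℝ) : Fin n → ℝ :=
  fun j => Real.exp (ψ j) / (1 + ∑ k, Real.exp (ψ k))

/-- Böhning's matrix `A = (1/2)(I_{D-1} - (1/D) 1 1ᵀ)`. -/
noncomputable def bohningA (D : ℕ) : Matrix (Fin (D - 1)) (Fin (D - 1)) ℝ :=
  (1 / 2 : ℝ) • ((1 : Matrix (Fin (D - 1)) (Fin (D - 1)) ℝ)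
    - ((D : ℝ))⁻¹ • Matrix.of (fun _ _ => (1 : ℝ)))

/-- Hoeffding's lemma for a finite weighted family of real numbers. -/
theorem sum_mul_exp_le_of_mem_Icc {ι : Type*} [Fintype ι] (p u : ι → ℝ) (hp : ∀ i, 0 ≤ p i)
    (hsum : ∑ i, p i = 1) {a b : ℝ} (hu : ∀ i, u i ∈ Set.Icc a b) :
    ∑ i, p i * Real.exp (u i) ≤ Real.exp (∑ i, p i * u i + (b - a) ^ 2 / 8) := by
  let _ : MeasurableSpace ι := ⊤
  have _ : MeasurableSingletonClass ι := ⟨fun _ => trivial⟩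
  let P : PMF ι := PMF.ofFintype (fun i => ENNReal.ofReal (p i)) (by
    rw [← ENNReal.ofReal_sum_of_nonneg fun i _ => hp i, hsum, ENNReal.ofReal_one])
  have hint : ∀ f : ι → ℝ, ∫ i, f i ∂P.toMeasure = ∑ i, p i * f i := fun f => by
    rw [PMF.integral_eq_sum]
    exact Finset.sum_congr rfl fun i _ => by simp [P, hp i]
  have h := (ProbabilityTheory.hasSubgaussianMGF_of_mem_Icc (μ := P.toMeasure) (X := u)
    (measurable_from_top.aemeasurable) (Filter.Eventually.of_forall hu)).mgf_le 1
  rw [ProbabilityTheory.mgf, hint, hint] at h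
  calc ∑ i, p i * Real.exp (u i)
      = Real.exp (∑ i, p i * u i) *
          ∑ i, p i * Real.exp (1 * (u i - ∑ j, p j * u j)) := by
        rw [Finset.mul_sum]
        refine Finset.sum_congr rfl fun i _ => ?_
        rw [mul_left_comm, ← Real.exp_add]
        ring_nf
    _ ≤ Real.exp (∑ i, p i * u i) * Real.exp ((b - a) ^ 2 / 8) := by
        refine mul_le_mul_of_nonneg_left (h.trans_eq ?_) (Real.exp_pos _).le
        congr 1
        push_cast
        rw [Real.norm_eq_abs, div_pow, sq_abs]
        ring
    _ = _ := (Real.exp_add _ _).symm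

theorem sq_sub_le_two_mul_sum_sq_sub {ι : Type*} [Fintype ι] (u : ι → ℝ) (c : ℝ) (i j : ι) :
    (u i - u j) ^ 2 ≤ 2 * ∑ k, (u k - c) ^ 2 := by
  classical
  by_cases hij : i = j
  · subst hij
    simpa using Finset.sum_nonneg fun k _ => sq_nonneg (u k - c)
  · have h := Finset.sum_le_sum_of_subset_of_nonneg (Finset.subset_univ {i, j})
      fun k _ _ => sq_nonneg (u k - c)
    rw [Finset.sum_pair hij] at h
    nlinarith [sq_nonneg ((u i - c) + (u j - c))]

theorem sum_mul_exp_le_exp_sum_sq_sub {ι : Type*} [Fintype ι] [Nonempty ι] (p u : ι → ℝ)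
    (hp : ∀ i, 0 ≤ p i) (hsum : ∑ i, p i = 1) (c : ℝ) :
    ∑ i, p i * Real.exp (u i) ≤
      Real.exp (∑ i, p i * u i + (1 / 4) * ∑ i, (u i - c) ^ 2) := by
  obtain ⟨i, hi⟩ := Finite.exists_max u
  obtain ⟨j, hj⟩ := Finite.exists_min u
  refine (sum_mul_exp_le_of_mem_Icc p u hp hsum fun k => ⟨hj k, hi k⟩).trans ?_
  rw [Real.exp_le_exp]
  linarith [sq_sub_le_two_mul_sum_sq_sub u c i j]

theorem one_add_sum_exp_pos {n : ℕ} (ψ : Fin n → ℝ) : 0 < 1 + ∑ j, Real.exp (ψ j) :=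
  add_pos_of_pos_of_nonneg one_pos (Finset.sum_nonneg fun _ _ => (Real.exp_pos _).le)

/-- Böhning's quadratic upper bound on the log-sum-exp function. -/
theorem lse_add_le {n : ℕ} (ψ u : Fin n → ℝ) :
    lse (ψ + u) ≤ lse ψ + u ⬝ᵥ probVec ψ
      + (1 / 4) * (∑ i, u i ^ 2 - (∑ i, u i) ^ 2 / (n + 1)) := by
  have hS := one_add_sum_exp_pos ψ
  have hn : (n : ℝ) + 1 ≠ 0 := by positivity
  have h := sum_mul_exp_le_exp_sum_sq_sub
    (fun o : Option (Fin n) => o.elim (1 / (1 + ∑ j, Real.exp (ψ j))) (probVec ψ))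
    (fun o => o.elim 0 u)
    (by
      rintro (_ | i)
      · exact (one_div_pos.2 hS).le
      · exact div_nonneg (Real.exp_pos _).le hS.le)
    (by
      simp only [Fintype.sum_option, Option.elim, probVec]
      rw [← Finset.sum_div, ← add_div, div_self hS.ne'])
    ((∑ i, u i) / (n + 1))
  simp only [Fintype.sum_option, Option.elim, Real.exp_zero, mul_one, mul_zero, zero_add] at h
  have hl : 1 / (1 + ∑ j, Real.exp (ψ j)) + ∑ i, probVec ψ i * Real.exp (u i)
      = (1 + ∑ j, Real.exp ((ψ + u) j)) / (1 + ∑ j, Real.exp (ψ j)) := by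
    simp only [probVec, Pi.add_apply, Real.exp_add]
    rw [add_div, Finset.sum_div]
    congr 1
    exact Finset.sum_congr rfl fun i _ => by ring
  have hvar : (0 - (∑ i, u i) / (n + 1)) ^ 2 + ∑ i, (u i - (∑ j, u j) / (n + 1)) ^ 2
      = ∑ i, u i ^ 2 - (∑ i, u i) ^ 2 / (n + 1) := by
    simp only [sub_sq, Finset.sum_add_distrib, Finset.sum_sub_distrib, ← Finset.sum_mul,
      ← Finset.mul_sum, Finset.sum_const, Finset.card_univ, Fintype.card_fin, nsmul_eq_mul]
    field_simp
    ring
  rw [hl, hvar, ← Real.log_le_iff_le_exp (div_pos (one_add_sum_exp_pos _) hS),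
    Real.log_div (one_add_sum_exp_pos _).ne' hS.ne'] at h
  have hdot : ∑ i, probVec ψ i * u i = u ⬝ᵥ probVec ψ := dotProduct_comm _ _
  rw [hdot] at h
  unfold lse
  linarith

theorem dotProduct_bohningA_mulVec (D : ℕ) (x y : Fin (D - 1) → ℝ) :
    x ⬝ᵥ (bohningA D).mulVec y
      = (1 / 2) * (x ⬝ᵥ y - (∑ i, x i) * (∑ i, y i) / D) := by
  have h : (Matrix.of fun _ _ => (1 : ℝ)).mulVec y = fun _ : Fin (D - 1) => ∑ i, y i := by
    ext i
    simp [mulVec, dotProduct]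
  have h' : (x ⬝ᵥ fun _ : Fin (D - 1) => ∑ i, y i) = (∑ i, x i) * ∑ i, y i :=
    (Finset.sum_mul _ _ _).symm
  rw [bohningA, smul_mulVec, sub_mulVec, one_mulVec, smul_mulVec, h, dotProduct_smul,
    dotProduct_sub, dotProduct_smul, h', smul_eq_mul, smul_eq_mul]
  ring

/-- (Multinomial likelihood lower bound) With `z̃ = z - N(p_ψ - Aψ)` and
`κ(ψ) = N(ψᵀ p_ψ - lse(ψ) - (1/2) ψᵀ A ψ)`, for every `η`:
`exp(ηᵀ z - N lse(η)) ≥ exp(ηᵀ z̃ - (N/2) ηᵀ A η + κ(ψ))`. -/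
theorem multinomial_likelihood_lower_bound {D : ℕ} (hD : 2 ≤ D)
    (N : ℝ) (hN : 0 ≤ N) (z ψ : Fin (D - 1) → ℝ) :
    let zt : Fin (D - 1) → ℝ := z - N • (probVec ψ - (bohningA D).mulVec ψ)
    let κ : ℝ := N * (ψ ⬝ᵥ probVec ψ - lse ψ - (1 / 2) * (ψ ⬝ᵥ (bohningA D).mulVec ψ))
    ∀ η : Fin (D - 1) → ℝ,
      Real.exp (η ⬝ᵥ zt - (N / 2) * (η ⬝ᵥ (bohningA D).mulVec η) + κ)
        ≤ Real.exp (η ⬝ᵥ z - N * lse η) := by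
  intro zt κ η
  rw [Real.exp_le_exp]
  have h := lse_add_le ψ (η - ψ)
  have hcast : ((D - 1 : ℕ) : ℝ) + 1 = D := by
    exact_mod_cast Nat.sub_add_cancel (one_le_two.trans hD)
  have hsq : ∑ i, (η - ψ) i ^ 2 = η ⬝ᵥ η - 2 * (η ⬝ᵥ ψ) + ψ ⬝ᵥ ψ := by
    simp only [dotProduct, Finset.mul_sum, ← Finset.sum_sub_distrib, ← Finset.sum_add_distrib]
    exact Finset.sum_congr rfl fun i _ => by rw [Pi.sub_apply]; ring
  have hsum : ∑ i, (η - ψ) i = ∑ i, η i - ∑ i, ψ i := Finset.sum_sub_distrib ..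
  rw [add_sub_cancel, hcast, hsq, hsum, sub_dotProduct] at h
  have hN' := mul_le_mul_of_nonneg_left h hN
  simp only [zt, κ, dotProduct_sub, dotProduct_smul, smul_eq_mul, dotProduct_bohningA_mulVec]
  linear_combination hN'
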